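/- For every integer n ≥ 1 there exist constants δ₀ ∈ (0,1), C > 0 and c > 0 such that the following holds: for every ε > 0, every r > 0, and every smooth u : ℝ² → ℝ^{n+1} satisfying −Δu = (1/ε²)(1−|u|²)u on the open ball B_r with |u(x)| ≤ 1 for all x ∈ B_r, if ∫_{B_r} e_ε(u) < δ₀, then for every x ∈ B_{r/4} one has r²·|Δu(x)| ≤ C ∫_{B_r} e_ε(u) + C·(r²/ε²)·e^{−c r/ε}. -/

import Mathlib

open MeasureTheory Metric Real

noncomputable section

/-- Euclidean plane. -/
abbrev E2 : Type := EuclideanSpace ℝ (Fin 2)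

/-- Partial derivative in the `k`-th coordinate direction. -/
def pd {F : Type} [NormedAddCommGroup F] [NormedSpace ℝ F]
    (k : Fin 2) (f : E2 → F) (x : E2) : F :=
  fderiv ℝ f x (EuclideanSpace.single k 1)

/-- Euclidean Laplacian, acting componentwise. -/
def lap {F : Type} [NormedAddCommGroup F] [NormedSpace ℝ F]
    (f : E2 → F) (x : E2) : F :=
  pd 0 (pd 0 f) x + pd 1 (pd 1 f) x

/-- Squared Frobenius norm of the total derivative. -/
def gradSqNorm {F : Type} [NormedAddCommGroup F] [NormedSpace ℝ F]
    (f : E2 → F) (x : E2) : ℝ :=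
  ∑ k : Fin 2, ‖pd k f x‖ ^ 2

/-- Ginzburg–Landau energy density `e_ε(u) = ½|Du|² + (1−|u|²)²/(4ε²)`. -/
def eDens {F : Type} [NormedAddCommGroup F] [NormedSpace ℝ F]
    (ε : ℝ) (f : E2 → F) (x : E2) : ℝ :=
  gradSqNorm f x / 2 + (1 - ‖f x‖ ^ 2) ^ 2 / (4 * ε ^ 2)

section calculus

variable {F : Type} [NormedAddCommGroup F] [InnerProductSpace ℝ F]

lemma pd_contDiff {f : E2 → F} (hf : ContDiff ℝ (⊤ : ℕ∞) f) (k : Fin 2) :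
    ContDiff ℝ (⊤ : ℕ∞) (pd k f) := by
  unfold pd
  exact (hf.fderiv_right (m := (⊤ : ℕ∞)) (by simp)).clm_apply contDiff_const

lemma cd_diff {f : E2 → F} (hf : ContDiff ℝ (⊤ : ℕ∞) f) : Differentiable ℝ f :=
  hf.differentiable (by simp)

lemma lap_contDiff {f : E2 → F} (hf : ContDiff ℝ (⊤ : ℕ∞) f) :
    ContDiff ℝ (⊤ : ℕ∞) (lap f) :=
  (pd_contDiff (pd_contDiff hf 0) 0).add (pd_contDiff (pd_contDiff hf 1) 1)

lemma pd_add {f g : E2 → F} (hf : Differentiable ℝ f) (hg : Differentiable ℝ g) (k : Fin 2) :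
    pd k (fun x => f x + g x) = fun x => pd k f x + pd k g x := by
  ext x
  simp only [pd]
  rw [fderiv_fun_add (hf x) (hg x)]
  rfl

lemma pd_sub {f g : E2 → F} (hf : Differentiable ℝ f) (hg : Differentiable ℝ g) (k : Fin 2) :
    pd k (fun x => f x - g x) = fun x => pd k f x - pd k g x := by
  ext x
  simp only [pd]
  rw [fderiv_fun_sub (hf x) (hg x)]
  rfl

lemma pd_const_mul {f : E2 → ℝ} (hf : Differentiable ℝ f) (c : ℝ) (k : Fin 2) :
    pd k (fun x => c * f x) = fun x => c * pd k f x := by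
  ext x
  simp only [pd]
  rw [fderiv_const_mul (hf x)]
  rfl

lemma pd_const (c : F) (k : Fin 2) : pd k (fun _ : E2 => c) = fun _ => 0 := by
  ext x
  simp [pd]

lemma pd_smul {h : E2 → ℝ} {f : E2 → F} (hh : Differentiable ℝ h) (hf : Differentiable ℝ f)
    (k : Fin 2) : pd k (fun x => h x • f x) = fun x => pd k h x • f x + h x • pd k f x := by
  ext x
  simp only [pd]
  rw [fderiv_fun_smul (hh x) (hf x)]
  simp [add_comm]

lemma pd_inner {f g : E2 → F} (hf : Differentiable ℝ f) (hg : Differentiable ℝ g) (k : Fin 2) :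
    pd k (fun x => inner ℝ (f x) (g x)) =
      fun x => inner ℝ (f x) (pd k g x) + inner ℝ (pd k f x) (g x) := by
  ext x
  simp only [pd]
  rw [fderiv_inner_apply ℝ (hf x) (hg x)]

lemma pd_comm {f : E2 → F} (hf : ContDiff ℝ (⊤ : ℕ∞) f) (j k : Fin 2) :
    pd j (pd k f) = pd k (pd j f) := by
  ext x
  have hd : DifferentiableAt ℝ (fderiv ℝ f) x :=
    ((hf.fderiv_right (m := (⊤ : ℕ∞)) (by simp)).differentiable (by simp)) x
  have key : ∀ a b : Fin 2, pd a (pd b f) x =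
      fderiv ℝ (fderiv ℝ f) x (EuclideanSpace.single a 1) (EuclideanSpace.single b 1) := by
    intro a b
    unfold pd
    rw [fderiv_clm_apply hd (differentiableAt_const _)]
    simp
  rw [key, key]
  exact (hf.contDiffAt.isSymmSndFDerivAt (by
    simp only [minSmoothness_of_isRCLikeNormedField]
    exact WithTop.coe_le_coe.2 (le_top : (2 : ℕ∞) ≤ ⊤))) _ _

lemma lap_add {f g : E2 → F} (hf : ContDiff ℝ (⊤ : ℕ∞) f) (hg : ContDiff ℝ (⊤ : ℕ∞) g) (x : E2) :
    lap (fun x => f x + g x) x = lap f x + lap g x := by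
  unfold lap
  simp only [pd_add (cd_diff hf) (cd_diff hg), pd_add (cd_diff (pd_contDiff hf _))
    (cd_diff (pd_contDiff hg _))]
  abel

lemma lap_sub {f g : E2 → F} (hf : ContDiff ℝ (⊤ : ℕ∞) f) (hg : ContDiff ℝ (⊤ : ℕ∞) g) (x : E2) :
    lap (fun x => f x - g x) x = lap f x - lap g x := by
  unfold lap
  simp only [pd_sub (cd_diff hf) (cd_diff hg), pd_sub (cd_diff (pd_contDiff hf _))
    (cd_diff (pd_contDiff hg _))]
  abel

lemma lap_const (c : F) (x : E2) : lap (fun _ => c) x = 0 := by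
  unfold lap
  simp only [pd_const]
  simp

lemma lap_const_mul {f : E2 → ℝ} (hf : ContDiff ℝ (⊤ : ℕ∞) f) (c : ℝ) (x : E2) :
    lap (fun x => c * f x) x = c * lap f x := by
  unfold lap
  simp only [pd_const_mul (cd_diff hf), pd_const_mul (cd_diff (pd_contDiff hf _))]
  ring

lemma lap_inner_self {f : E2 → F} (hf : ContDiff ℝ (⊤ : ℕ∞) f) (x : E2) :
    lap (fun x => inner ℝ (f x) (f x)) x = 2 * gradSqNorm f x + 2 * inner ℝ (f x) (lap f x) := by
  have h0 : ∀ k, pd k (pd k (fun x => inner ℝ (f x) (f x))) x =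
      2 * ‖pd k f x‖ ^ 2 + 2 * inner ℝ (f x) (pd k (pd k f) x) := by
    intro k
    have hk := pd_contDiff hf k
    rw [pd_inner (cd_diff hf) (cd_diff hf), pd_add (cd_diff (hf.inner ℝ hk)) (cd_diff (hk.inner ℝ hf)),
      pd_inner (cd_diff hf) (cd_diff hk), pd_inner (cd_diff hk) (cd_diff hf)]
    simp only [real_inner_self_eq_norm_sq, real_inner_comm (f x)]
    ring
  unfold lap gradSqNorm
  rw [h0, h0, Fin.sum_univ_two, inner_add_right]
  ring

lemma lap_pd {f : E2 → F} (hf : ContDiff ℝ (⊤ : ℕ∞) f) (k : Fin 2) :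
    lap (pd k f) = pd k (lap f) := by
  have : lap f = fun x => pd 0 (pd 0 f) x + pd 1 (pd 1 f) x := rfl
  rw [this, pd_add (cd_diff (pd_contDiff (pd_contDiff hf 0) 0))
    (cd_diff (pd_contDiff (pd_contDiff hf 1) 1))]
  ext x
  unfold lap
  rw [pd_comm (pd_contDiff hf 0) k 0, pd_comm (pd_contDiff hf 1) k 1, pd_comm hf k 0,
    pd_comm hf k 1]

lemma gradSq_nonneg (f : E2 → F) (x : E2) : 0 ≤ gradSqNorm f x :=
  Finset.sum_nonneg fun _ _ => sq_nonneg _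

lemma eDens_nonneg (ε : ℝ) (f : E2 → F) (x : E2) : 0 ≤ eDens ε f x := by
  have := gradSq_nonneg f x
  unfold eDens
  positivity

/-- the function `1 - |u|²`. -/
def ff (u : E2 → F) (x : E2) : ℝ := 1 - inner ℝ (u x) (u x)

lemma ff_eq (u : E2 → F) (x : E2) : ff u x = 1 - ‖u x‖ ^ 2 := by
  simp [ff]

lemma ff_contDiff {u : E2 → F} (hu : ContDiff ℝ (⊤ : ℕ∞) u) : ContDiff ℝ (⊤ : ℕ∞) (ff u) :=
  contDiff_const.sub (hu.inner ℝ hu)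

lemma pd_ff {u : E2 → F} (hu : ContDiff ℝ (⊤ : ℕ∞) u) (k : Fin 2) (x : E2) :
    pd k (ff u) x = - 2 * inner ℝ (u x) (pd k u x) := by
  have : ff u = fun x => (1 : ℝ) - inner ℝ (u x) (u x) := rfl
  rw [this, pd_sub (differentiable_const _) (cd_diff (hu.inner ℝ hu)), pd_const,
    pd_inner (cd_diff hu) (cd_diff hu)]
  simp only [real_inner_comm (u x)]
  ring

lemma lap_ff {u : E2 → F} (hu : ContDiff ℝ (⊤ : ℕ∞) u) (x : E2) :
    lap (ff u) x = - 2 * gradSqNorm u x - 2 * inner ℝ (u x) (lap u x) := by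
  have : ff u = fun x => (1 : ℝ) - inner ℝ (u x) (u x) := rfl
  rw [this, lap_sub contDiff_const (hu.inner ℝ hu), lap_const, lap_inner_self hu]
  ring

lemma eDens_eq (ε : ℝ) (u : E2 → F) :
    eDens ε u = fun x => (1 / 2) * (inner ℝ (pd 0 u x) (pd 0 u x) + inner ℝ (pd 1 u x) (pd 1 u x))
      + (1 / (4 * ε ^ 2)) * inner ℝ (ff u x) (ff u x) := by
  ext x
  simp only [eDens, gradSqNorm, Fin.sum_univ_two, real_inner_self_eq_norm_sq, ff_eq,
    Real.norm_eq_abs, sq_abs]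
  ring

lemma eDens_contDiff (ε : ℝ) {u : E2 → F} (hu : ContDiff ℝ (⊤ : ℕ∞) u) :
    ContDiff ℝ (⊤ : ℕ∞) (eDens ε u) := by
  rw [eDens_eq]
  exact (contDiff_const.mul (((pd_contDiff hu 0).inner ℝ (pd_contDiff hu 0)).add
    ((pd_contDiff hu 1).inner ℝ (pd_contDiff hu 1)))).add
    (contDiff_const.mul ((ff_contDiff hu).inner ℝ (ff_contDiff hu)))

lemma bochner {ε r : ℝ} (hε : 0 < ε) {u : E2 → F} (hu : ContDiff ℝ (⊤ : ℕ∞) u)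
    (heq : ∀ x ∈ ball (0 : E2) r, -lap u x = ((1 / ε ^ 2) * (1 - ‖u x‖ ^ 2)) • u x)
    {x : E2} (hx : x ∈ ball (0 : E2) r) :
    - 2 * (ff u x / ε ^ 2) * gradSqNorm u x + (1 - ff u x) * (ff u x / ε ^ 2) ^ 2
      ≤ lap (eDens ε u) x := by
  have h0 := pd_contDiff hu 0
  have h1 := pd_contDiff hu 1
  have hf := ff_contDiff hu
  have hlapu : lap u x = (- (1 / ε ^ 2) * ff u x) • u x := by
    rw [← neg_neg (lap u x), heq x hx, ff_eq, ← neg_smul]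
    congr 1
    ring
  have hpd : ∀ k, pd k (lap u) x = (- (1 / ε ^ 2) * pd k (ff u) x) • u x
      + (- (1 / ε ^ 2) * ff u x) • pd k u x := by
    intro k
    have he : lap u =ᶠ[nhds x] fun y => (- (1 / ε ^ 2) * ff u y) • u y := by
      filter_upwards [isOpen_ball.mem_nhds hx] with y hy
      rw [← neg_neg (lap u y), heq y hy, ff_eq, ← neg_smul]
      congr 1
      ring
    have h2 : pd k (lap u) x = pd k (fun y => (- (1 / ε ^ 2) * ff u y) • u y) x := by
      unfold pd
      rw [he.fderiv_eq]
    rw [h2, pd_smul (cd_diff (contDiff_const.mul hf)) (cd_diff hu), pd_const_mul (cd_diff hf)]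
  rw [eDens_eq, lap_add (contDiff_const.mul ((h0.inner ℝ h0).add (h1.inner ℝ h1)))
    (contDiff_const.mul (hf.inner ℝ hf)), lap_const_mul ((h0.inner ℝ h0).add (h1.inner ℝ h1)),
    lap_const_mul (hf.inner ℝ hf), lap_add (h0.inner ℝ h0) (h1.inner ℝ h1), lap_inner_self h0,
    lap_inner_self h1, lap_inner_self hf, lap_ff hu, lap_pd hu, lap_pd hu, hpd, hpd, hlapu]
  have e1 : inner ℝ (u x) (u x) = 1 - ff u x := by simp [ff]
  have g : ∀ k, inner ℝ (u x) (pd k u x) = - pd k (ff u) x / 2 := by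
    intro k
    rw [pd_ff hu]
    ring
  have g' : ∀ k, inner ℝ (pd k u x) (u x) = - pd k (ff u) x / 2 := by
    intro k
    rw [real_inner_comm, g]
  simp only [inner_add_right, real_inner_smul_right, e1, g', real_inner_self_eq_norm_sq]
  have a0 := gradSq_nonneg (pd 0 u) x
  have a1 := gradSq_nonneg (pd 1 u) x
  have hr : inner ℝ (ff u x) (-2 * gradSqNorm u x - 2 * (-(1 / ε ^ 2) * ff u x * (1 - ff u x)))
    = ff u x * (-2 * gradSqNorm u x - 2 * (-(1 / ε ^ 2) * ff u x * (1 - ff u x))) := by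
    simp [mul_comm]
  rw [hr]
  have hgf : gradSqNorm (ff u) x = pd 0 (ff u) x ^ 2 + pd 1 (ff u) x ^ 2 := by
    simp [gradSqNorm]
  have hgu : gradSqNorm u x = ‖pd 0 u x‖ ^ 2 + ‖pd 1 u x‖ ^ 2 := by
    simp [gradSqNorm]
  rw [hgf, hgu]
  have a2 : 0 ≤ (1 / ε ^ 2) * pd 0 (ff u) x ^ 2 := by positivity
  have a3 : 0 ≤ (1 / ε ^ 2) * pd 1 (ff u) x ^ 2 := by positivity
  have hd : ∀ z : ℝ, z / ε ^ 2 = (1 / ε ^ 2) * z := by intro z; ring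
  have hd4 : 1 / (4 * ε ^ 2) = (1 / ε ^ 2) / 4 := by
    field_simp
  rw [hd4, hd (ff u x)]
  generalize 1 / ε ^ 2 = q at *
  nlinarith

end calculus

section meanvalue

lemma hasDerivAt_maxsq (t : ℝ) : HasDerivAt (fun t : ℝ => (max t 0) ^ 2) (2 * max t 0) t := by
  rcases lt_trichotomy t 0 with h | h | h
  · have : (fun t : ℝ => (max t 0) ^ 2) =ᶠ[nhds t] fun _ => 0 := by
      filter_upwards [gt_mem_nhds h] with y hy
      simp [max_eq_right hy.le]
    rw [max_eq_right h.le, mul_zero]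
    exact (hasDerivAt_const t (0 : ℝ)).congr_of_eventuallyEq this
  · subst h
    simp only [max_self, mul_zero]
    have : (fun t : ℝ => (max t 0) ^ 2) =O[nhds 0] fun x => ‖x - 0‖ ^ 2 := by
      refine Asymptotics.IsBigO.of_bound 1 (Filter.Eventually.of_forall fun x => ?_)
      rw [sub_zero, Real.norm_eq_abs, Real.norm_eq_abs, abs_pow, one_mul, Real.norm_eq_abs,
        abs_pow, abs_abs]
      refine pow_le_pow_left₀ (abs_nonneg _) ?_ 2
      rw [abs_of_nonneg (le_max_right x 0)]
      exact max_le (le_abs_self x) (abs_nonneg x)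
    have h2 := this.hasFDerivAt (𝕜 := ℝ) (by norm_num)
    have h3 := h2.hasDerivAt
    simpa using h3
  · have : (fun t : ℝ => (max t 0) ^ 2) =ᶠ[nhds t] fun t => t ^ 2 := by
      filter_upwards [lt_mem_nhds h] with y hy
      simp [max_eq_left hy.le]
    rw [max_eq_left h.le]
    simpa using (hasDerivAt_pow 2 t).congr_of_eventuallyEq this

def psi (y : E2) : ℝ := (max (1 - ‖y‖ ^ 2) 0) ^ 2

def phi (y : E2) : ℝ := 4 * max (1 - ‖y‖ ^ 2) 0

lemma psi_nonneg (y : E2) : 0 ≤ psi y := sq_nonneg _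

lemma phi_nonneg (y : E2) : 0 ≤ phi y := mul_nonneg (by norm_num) (le_max_right _ _)

lemma phi_le (y : E2) : phi y ≤ 4 := by
  unfold phi
  have : max (1 - ‖y‖ ^ 2) 0 ≤ 1 := max_le (by nlinarith [sq_nonneg ‖y‖]) zero_le_one
  linarith

lemma max_zero_of {y : E2} (hy : 1 ≤ ‖y‖) : max (1 - ‖y‖ ^ 2) 0 = 0 :=
  max_eq_right (by nlinarith)

lemma psi_zero {y : E2} (hy : 1 ≤ ‖y‖) : psi y = 0 := by simp [psi, max_zero_of hy]

lemma phi_zero {y : E2} (hy : 1 ≤ ‖y‖) : phi y = 0 := by simp [phi, max_zero_of hy]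

lemma psi_cont : Continuous psi := by unfold psi; fun_prop

lemma phi_cont : Continuous phi := by unfold phi; fun_prop

lemma psi_supp : HasCompactSupport psi :=
  HasCompactSupport.intro (isCompact_closedBall (0 : E2) 1) fun y hy => psi_zero (by
    simp only [mem_closedBall, dist_zero_right, not_le] at hy
    exact hy.le)

lemma phi_supp : HasCompactSupport phi :=
  HasCompactSupport.intro (isCompact_closedBall (0 : E2) 1) fun y hy => phi_zero (by
    simp only [mem_closedBall, dist_zero_right, not_le] at hy
    exact hy.le)

lemma psi_hasFDerivAt (y : E2) : HasFDerivAt psi (-(phi y) • innerSL ℝ y) y := by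
  have h1 : HasFDerivAt (fun y : E2 => 1 - ‖y‖ ^ 2) (-(2 • innerSL ℝ y)) y :=
    (hasStrictFDerivAt_norm_sq y).hasFDerivAt.const_sub 1
  have h2 := (hasDerivAt_maxsq (1 - ‖y‖ ^ 2)).comp_hasFDerivAt y h1
  refine h2.congr_fderiv ?_
  ext v
  simp [phi]
  ring

lemma psi_fderiv (y : E2) (k : Fin 2) :
    fderiv ℝ psi y (EuclideanSpace.single k 1) = - (phi y * y k) := by
  rw [(psi_hasFDerivAt y).fderiv]
  simp [PiLp.inner_apply]

/-- total mass of `phi` -/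
def mphi : ℝ := ∫ y, phi y

def mpsi : ℝ := ∫ y, psi y

lemma mphi_pos : 0 < mphi :=
  phi_cont.integral_pos_of_hasCompactSupport_nonneg_nonzero phi_supp phi_nonneg
    (x := 0) (by simp [phi])

lemma mpsi_pos : 0 < mpsi :=
  psi_cont.integral_pos_of_hasCompactSupport_nonneg_nonzero psi_supp psi_nonneg
    (x := 0) (by simp [psi])

lemma fderiv_expand (g : E2 → ℝ) (z y : E2) :
    fderiv ℝ g z y = y 0 * pd 0 g z + y 1 * pd 1 g z := by
  have : y = y 0 • EuclideanSpace.single (0 : Fin 2) (1 : ℝ)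
      + y 1 • EuclideanSpace.single (1 : Fin 2) (1 : ℝ) := by
    ext i
    fin_cases i <;> simp
  conv_lhs => rw [this]
  simp [pd]

lemma pd_comp_scale {g : E2 → ℝ} (hg : Differentiable ℝ g) (x₀ : E2) (t : ℝ) (k : Fin 2) (y : E2) :
    fderiv ℝ (fun y => g (x₀ + t • y)) y (EuclideanSpace.single k 1) = t * pd k g (x₀ + t • y) := by
  have h1 : HasFDerivAt (fun y : E2 => x₀ + t • y) (t • ContinuousLinearMap.id ℝ E2) y :=
    ((hasFDerivAt_id y).const_smul t).const_add x₀
  have h2 := (hg (x₀ + t • y)).hasFDerivAt.comp y h1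
  have h3 : fderiv ℝ (fun y => g (x₀ + t • y)) y = _ := h2.fderiv
  rw [h3]
  simp [pd]

lemma ibp {g : E2 → ℝ} (hg : ContDiff ℝ (⊤ : ℕ∞) g) (x₀ : E2) (t : ℝ) :
    ∫ y, phi y * fderiv ℝ g (x₀ + t • y) y = t * ∫ y, psi y * lap g (x₀ + t • y) := by
  have hc1 : ∀ k, Continuous fun y : E2 => pd k g (x₀ + t • y) := fun k =>
    (pd_contDiff hg k).continuous.comp (by fun_prop)
  have hc2 : ∀ k, Continuous fun y : E2 => pd k (pd k g) (x₀ + t • y) := fun k =>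
    (pd_contDiff (pd_contDiff hg k) k).continuous.comp (by fun_prop)
  have i1 : ∀ k : Fin 2, Integrable fun y : E2 => phi y * (y k * pd k g (x₀ + t • y)) := fun k =>
    (phi_cont.mul ((by fun_prop : Continuous fun y : E2 => y k).mul
      (hc1 k))).integrable_of_hasCompactSupport phi_supp.mul_right
  have i2 : ∀ k : Fin 2, Integrable fun y : E2 => psi y * pd k (pd k g) (x₀ + t • y) := fun k =>
    (psi_cont.mul (hc2 k)).integrable_of_hasCompactSupport psi_supp.mul_right
  have key : ∀ k : Fin 2, ∫ y, phi y * (y k * pd k g (x₀ + t • y)) =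
      t * ∫ y, psi y * pd k (pd k g) (x₀ + t • y) := by
    intro k
    have hdk := cd_diff (pd_contDiff hg k)
    have h := integral_mul_fderiv_eq_neg_fderiv_mul_of_integrable (μ := (volume : Measure E2))
      (f := fun y : E2 => pd k g (x₀ + t • y)) (g := psi) (v := EuclideanSpace.single k (1 : ℝ))
      ?_ ?_ ?_ ?_ ?_
    · simp only [psi_fderiv, pd_comp_scale hdk] at h
      rw [← integral_const_mul]
      have e1 : ∫ y, phi y * (y k * pd k g (x₀ + t • y)) =
          - ∫ y : E2, pd k g (x₀ + t • y) * -(phi y * y k) := by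
        rw [← integral_neg]
        congr 1
        ext y
        ring
      rw [e1, h, neg_neg]
      congr 1
      ext y
      ring
    · simp only [pd_comp_scale hdk]
      refine ((i2 k).const_mul t).congr (Filter.Eventually.of_forall fun y => ?_)
      simp only
      ring
    · simp only [psi_fderiv]
      refine (i1 k).neg.congr (Filter.Eventually.of_forall fun y => ?_)
      simp only [Pi.neg_apply]
      ring
    · exact ((hc1 k).mul psi_cont).integrable_of_hasCompactSupport psi_supp.mul_left
    · intro y _
      exact (hdk _).comp y (by fun_prop)
    · intro y _
      exact (psi_hasFDerivAt y).differentiableAt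
  simp only [fderiv_expand, lap, mul_add]
  rw [integral_add (i1 0) (i1 1), integral_add (i2 0) (i2 1), key, key]
  ring

lemma hasDerivAt_avg {g : E2 → ℝ} (hg : ContDiff ℝ (⊤ : ℕ∞) g) (x₀ : E2) (t : ℝ) :
    HasDerivAt (fun t : ℝ => ∫ y, phi y * g (x₀ + t • y))
      (∫ y, phi y * fderiv ℝ g (x₀ + t • y) y) t := by
  have hcf : Continuous fun p : ℝ × E2 => fderiv ℝ g (x₀ + p.1 • p.2) p.2 :=
    ((hg.continuous_fderiv (by simp)).comp (by fun_prop)).clm_apply continuous_snd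
  obtain ⟨B, hB⟩ := ((isCompact_closedBall t 1).prod
    (isCompact_closedBall (0 : E2) 1)).exists_bound_of_continuousOn hcf.continuousOn
  have hcg : ∀ t : ℝ, Continuous fun y : E2 => phi y * g (x₀ + t • y) := fun t =>
    phi_cont.mul (hg.continuous.comp (by fun_prop))
  refine (hasDerivAt_integral_of_dominated_loc_of_deriv_le (μ := (volume : Measure E2))
    (F := fun (t : ℝ) (y : E2) => phi y * g (x₀ + t • y))
    (F' := fun (t : ℝ) (y : E2) => phi y * fderiv ℝ g (x₀ + t • y) y)
    (bound := fun y => phi y * B) (s := closedBall t 1)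
    (closedBall_mem_nhds t one_pos) ?_ ?_ ?_ ?_ ?_ ?_).2
  · exact Filter.Eventually.of_forall fun t => (hcg t).aestronglyMeasurable
  · exact (hcg t).integrable_of_hasCompactSupport phi_supp.mul_right
  · refine (phi_cont.mul ?_).aestronglyMeasurable
    exact hcf.comp (by fun_prop : Continuous fun y : E2 => (t, y))
  · refine Filter.Eventually.of_forall fun y s hs => ?_
    rw [norm_mul, Real.norm_of_nonneg (phi_nonneg y)]
    by_cases hy : 1 ≤ ‖y‖
    · simp [phi_zero hy]
    · exact mul_le_mul_of_nonneg_left (hB (s, y) ⟨hs, by simpa using (not_le.1 hy).le⟩)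
        (phi_nonneg y)
  · exact (phi_cont.integrable_of_hasCompactSupport phi_supp).mul_const B
  · refine Filter.Eventually.of_forall fun y s _ => ?_
    have h1 : HasDerivAt (fun s : ℝ => x₀ + s • y) y s := by
      simpa using ((hasDerivAt_id s).smul_const y).const_add x₀
    exact ((cd_diff hg (x₀ + s • y)).hasFDerivAt.comp_hasDerivAt s h1).const_mul (phi y)

lemma mean_value {g : E2 → ℝ} (hg : ContDiff ℝ (⊤ : ℕ∞) g) (x₀ : E2) {s K : ℝ} (hs : 0 < s)
    (hK : ∀ x ∈ ball x₀ s, -K ≤ lap g x) :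
    mphi * g x₀ ≤ (∫ y, phi y * g (x₀ + s • y)) + K * mpsi * s ^ 2 / 2 := by
  set H : ℝ → ℝ := fun t => (∫ y, phi y * g (x₀ + t • y)) + K * mpsi * t ^ 2 / 2 with hH
  have hd : ∀ t, HasDerivAt H ((∫ y, phi y * fderiv ℝ g (x₀ + t • y) y) + K * mpsi * t) t := by
    intro t
    refine (hasDerivAt_avg hg x₀ t).add ?_
    have := (((hasDerivAt_pow 2 t).const_mul (K * mpsi)).div_const 2)
    refine this.congr_deriv ?_
    simp only [Nat.cast_ofNat, Nat.add_one_sub_one, pow_one]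
    ring
  have hmono : MonotoneOn H (Set.Icc 0 s) := by
    refine monotoneOn_of_deriv_nonneg (convex_Icc 0 s)
      (fun t _ => (hd t).continuousAt.continuousWithinAt)
      (fun t _ => (hd t).differentiableAt.differentiableWithinAt) ?_
    intro t ht
    rw [interior_Icc] at ht
    rw [(hd t).deriv, ibp hg]
    have hlc : Continuous fun y : E2 => psi y * lap g (x₀ + t • y) :=
      psi_cont.mul ((lap_contDiff hg).continuous.comp (by fun_prop))
    have : ∫ y, psi y * (-K) ≤ ∫ y, psi y * lap g (x₀ + t • y) := by
      refine integral_mono ((psi_cont.integrable_of_hasCompactSupport psi_supp).mul_const _)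
        (hlc.integrable_of_hasCompactSupport psi_supp.mul_right) fun y => ?_
      by_cases hy : 1 ≤ ‖y‖
      · simp [psi_zero hy]
      · refine mul_le_mul_of_nonneg_left (hK _ ?_) (psi_nonneg y)
        rw [mem_ball, dist_eq_norm, add_sub_cancel_left, norm_smul, Real.norm_of_nonneg ht.1.le]
        nlinarith [ht.1, ht.2, norm_nonneg y]
    rw [integral_mul_const] at this
    change mpsi * -K ≤ _ at this
    nlinarith [ht.1]
  have h0 : H 0 = mphi * g x₀ := by
    simp [hH, integral_mul_const, mphi]
  rw [← h0]
  exact hmono (Set.left_mem_Icc.2 hs.le) (Set.right_mem_Icc.2 hs.le) hs.le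

lemma mean_value_ball {g : E2 → ℝ} (hg : ContDiff ℝ (⊤ : ℕ∞) g) (hg0 : ∀ x, 0 ≤ g x) (x₀ : E2)
    {s K r : ℝ} (hs : 0 < s) (hsr : ball x₀ s ⊆ ball (0 : E2) r)
    (hK : ∀ x ∈ ball x₀ s, -K ≤ lap g x) :
    mphi * g x₀ ≤ 4 / s ^ 2 * (∫ y in ball (0 : E2) r, g y) + K * mpsi * s ^ 2 / 2 := by
  have h := mean_value hg x₀ hs hK
  set G : E2 → ℝ := (ball (0 : E2) r).indicator g with hG
  have hGi : Integrable G := by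
    rw [hG, integrable_indicator_iff measurableSet_ball]
    exact (hg.continuous.continuousOn.integrableOn_compact
      (isCompact_closedBall (0 : E2) r)).mono_set ball_subset_closedBall
  have h1 : ∫ y, 4 * G (x₀ + s • y) = 4 / s ^ 2 * ∫ y in ball (0 : E2) r, g y := by
    rw [integral_const_mul, Measure.integral_comp_smul volume (fun y => G (x₀ + y)) s,
      integral_add_left_eq_self, hG, integral_indicator measurableSet_ball]
    simp [abs_of_pos hs]
    ring
  have hc : Continuous fun y : E2 => phi y * g (x₀ + s • y) :=
    phi_cont.mul (hg.continuous.comp (by fun_prop))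
  have h2 : ∫ y, phi y * g (x₀ + s • y) ≤ ∫ y, 4 * G (x₀ + s • y) := by
    refine integral_mono (hc.integrable_of_hasCompactSupport phi_supp.mul_right)
      (((hGi.comp_add_left x₀).comp_smul hs.ne').const_mul 4) fun y => ?_
    by_cases hy : 1 ≤ ‖y‖
    · rw [phi_zero hy, zero_mul]
      exact mul_nonneg (by norm_num) (Set.indicator_nonneg (fun x _ => hg0 x) _)
    · have : x₀ + s • y ∈ ball (0 : E2) r := by
        apply hsr
        rw [mem_ball, dist_eq_norm, add_sub_cancel_left, norm_smul, Real.norm_of_nonneg hs.le]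
        nlinarith [norm_nonneg y]
      rw [hG, Set.indicator_of_mem this]
      exact mul_le_mul_of_nonneg_right (phi_le y) (hg0 _)
  linarith

end meanvalue

section maxprinciple

lemma pd_pd_nonpos {w : E2 → ℝ} (hw : ContDiff ℝ (⊤ : ℕ∞) w) {z : E2} (hz : IsLocalMax w z)
    (k : Fin 2) : pd k (pd k w) z ≤ 0 := by
  by_contra! hpos
  set e : E2 := EuclideanSpace.single k 1 with he
  have hl : ∀ t : ℝ, HasDerivAt (fun s : ℝ => z + s • e) e t := fun t => by
    simpa using ((hasDerivAt_id t).smul_const e).const_add z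
  have hder : ∀ g : E2 → ℝ, Differentiable ℝ g → ∀ t : ℝ,
      HasDerivAt (fun s : ℝ => g (z + s • e)) (pd k g (z + t • e)) t := fun g hg t =>
    (hg (z + t • e)).hasFDerivAt.comp_hasDerivAt t (hl t)
  set q : ℝ → ℝ := fun s => w (z + s • e) with hq
  have hq1 : deriv q = fun t => pd k w (z + t • e) := funext fun t => (hder w (cd_diff hw) t).deriv
  have hq2 : deriv (deriv q) 0 = pd k (pd k w) z := by
    rw [hq1, (hder _ (cd_diff (pd_contDiff hw k)) 0).deriv]
    simp
  have hcont : ContinuousAt (fun s : ℝ => z + s • e) 0 := (hl 0).continuousAt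
  have hmax : IsLocalMax q 0 := by
    have h0 : z + (0 : ℝ) • e = z := by simp
    have hz' : ∀ᶠ y in nhds (z + (0 : ℝ) • e), w y ≤ w z := by rw [h0]; exact hz
    have := hcont.eventually hz'
    filter_upwards [this] with s hs
    simpa [hq] using hs
  have hmin : IsLocalMin q 0 := isLocalMin_of_deriv_deriv_pos (by rw [hq2]; exact hpos)
    hmax.deriv_eq_zero (hder w (cd_diff hw) 0).continuousAt
  have heq : q =ᶠ[nhds 0] fun _ => q 0 := by
    filter_upwards [hmax, hmin] with s h1 h2
    exact le_antisymm h1 h2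
  have h3 := heq.deriv.deriv_eq
  rw [hq2] at h3
  simp at h3
  linarith

lemma max_principle {w : E2 → ℝ} (hw : ContDiff ℝ (⊤ : ℕ∞) w) (x₁ : E2) {ρ : ℝ} (hρ : 0 < ρ)
    (h1 : ∀ x ∈ ball x₁ ρ, 0 < w x → 0 < lap w x) (h2 : ∀ x ∈ sphere x₁ ρ, w x ≤ 0) :
    w x₁ ≤ 0 := by
  obtain ⟨z, hz, hmax⟩ := (isCompact_closedBall x₁ ρ).exists_isMaxOn
    ⟨x₁, mem_closedBall_self hρ.le⟩ hw.continuous.continuousOn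
  have hle : w x₁ ≤ w z := hmax (mem_closedBall_self hρ.le)
  by_contra! hpos
  have hzb : z ∈ ball x₁ ρ := by
    rcases (mem_closedBall.1 hz).lt_or_eq with h | h
    · exact h
    · have := h2 z h
      linarith
  have hloc : IsLocalMax w z := hmax.isLocalMax
    (Filter.mem_of_superset (isOpen_ball.mem_nhds hzb) ball_subset_closedBall)
  have := h1 z hzb (by linarith)
  have a := pd_pd_nonpos hw hloc 0
  have b := pd_pd_nonpos hw hloc 1
  unfold lap at this
  linarith

lemma pd_coord {h h' : ℝ → ℝ} (hh : ∀ t, HasDerivAt h (h' t) t) (j k : Fin 2) :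
    pd j (fun x : E2 => h (x k)) = fun x => (if k = j then 1 else 0) * h' (x k) := by
  ext x
  have h1 : HasFDerivAt (fun x : E2 => x k) (EuclideanSpace.proj k : E2 →L[ℝ] ℝ) x :=
    (EuclideanSpace.proj k : E2 →L[ℝ] ℝ).hasFDerivAt
  have h2 := (hh (x k)).comp_hasFDerivAt x h1
  have h3 : fderiv ℝ (fun x : E2 => h (x k)) x = _ := h2.fderiv
  unfold pd
  rw [h3]
  simp [PiLp.single_apply, mul_comm]

lemma lap_cosh (a ε : ℝ) (k : Fin 2) (x : E2) :
    lap (fun x : E2 => Real.cosh ((x k - a) / ε)) x = Real.cosh ((x k - a) / ε) / ε ^ 2 := by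
  have d0 : ∀ t : ℝ, HasDerivAt (fun t => (t - a) / ε) (1 / ε) t := fun t =>
    ((hasDerivAt_id t).sub_const a).div_const ε
  have d1 : ∀ t, HasDerivAt (fun t => Real.cosh ((t - a) / ε))
      (Real.sinh ((t - a) / ε) * (1 / ε)) t := fun t => (d0 t).cosh
  have d2 : ∀ c t, HasDerivAt (fun t => c * (Real.sinh ((t - a) / ε) * (1 / ε)))
      (c * (Real.cosh ((t - a) / ε) * (1 / ε) * (1 / ε))) t := fun c t =>
    (((d0 t).sinh).mul_const (1 / ε)).const_mul c
  unfold lap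
  simp only [pd_coord d1, pd_coord (d2 _)]
  fin_cases k <;> simp <;> ring

lemma cosh_contDiff (a ε : ℝ) (k : Fin 2) :
    ContDiff ℝ (⊤ : ℕ∞) (fun x : E2 => Real.cosh ((x k - a) / ε)) := by
  have h1 : ContDiff ℝ (⊤ : ℕ∞) (fun x : E2 => x k) :=
    (EuclideanSpace.proj k : E2 →L[ℝ] ℝ).contDiff
  exact ((h1.sub contDiff_const).div_const ε).cosh

end maxprinciple

section main

variable {F : Type} [NormedAddCommGroup F] [InnerProductSpace ℝ F]

lemma ff_nonneg {u : E2 → F} {x : E2} (h : ‖u x‖ ≤ 1) : 0 ≤ ff u x := by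
  rw [ff_eq]
  nlinarith [norm_nonneg (u x)]

lemma ff_le_one (u : E2 → F) (x : E2) : ff u x ≤ 1 := by
  rw [ff_eq]
  nlinarith [sq_nonneg ‖u x‖]

lemma eDens_ff (ε : ℝ) (u : E2 → F) (x : E2) :
    eDens ε u x = gradSqNorm u x / 2 + ff u x ^ 2 / (4 * ε ^ 2) := by
  rw [ff_eq]; rfl

lemma lap_e_lower {ε r e₀ : ℝ} (hε : 0 < ε) {u : E2 → F} (hu : ContDiff ℝ (⊤ : ℕ∞) u)
    (heq : ∀ x ∈ ball (0 : E2) r, -lap u x = ((1 / ε ^ 2) * (1 - ‖u x‖ ^ 2)) • u x)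
    (hb : ∀ x ∈ ball (0 : E2) r, ‖u x‖ ≤ 1)
    {x : E2} (hx : x ∈ ball (0 : E2) r) (he : eDens ε u x ≤ 4 * e₀) :
    -(1024 * e₀ ^ 2) ≤ lap (eDens ε u) x := by
  refine le_trans ?_ (bochner hε hu heq hx)
  rw [eDens_ff] at he
  have hf0 := ff_nonneg (hb x hx)
  have hf1 := ff_le_one u x
  have hp0 := gradSq_nonneg u x
  generalize gradSqNorm u x = p at *
  generalize ff u x = f at *
  have hq : f ^ 2 / (4 * ε ^ 2) = f * (f / ε ^ 2) / 4 := by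
    field_simp
  rw [hq] at he
  have hfq : f = (f / ε ^ 2) * ε ^ 2 := by field_simp
  have hq0 : 0 ≤ f / ε ^ 2 := by positivity
  generalize f / ε ^ 2 = q at *
  have hfq0 : 0 ≤ f * q := by positivity
  have hp : p ≤ 8 * e₀ := by linarith
  have he0 : 0 ≤ e₀ := by linarith
  by_cases h : f ≤ 1 / 2
  · have h1 : p ^ 2 ≤ (8 * e₀) ^ 2 := by gcongr
    nlinarith [sq_nonneg (q - 2 * p), mul_nonneg (sub_nonneg.2 h) (sq_nonneg q), sq_nonneg e₀]
  · push Not at h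
    have h1 : q ≤ 32 * e₀ := by nlinarith
    have h2 : q * p ≤ (32 * e₀) * (8 * e₀) := by gcongr
    nlinarith [mul_nonneg (sub_nonneg.2 hf1) (sq_nonneg q), sq_nonneg e₀]

/-- ε-regularity -/
lemma small_energy : ∃ δ₀ ∈ Set.Ioo (0 : ℝ) 1, ∃ A > (0 : ℝ),
    ∀ (F : Type) [NormedAddCommGroup F] [InnerProductSpace ℝ F] (ε : ℝ), 0 < ε → ∀ (r : ℝ), 0 < r →
      ∀ (u : E2 → F), ContDiff ℝ (⊤ : ℕ∞) u →
        (∀ x ∈ ball (0 : E2) r, -lap u x = ((1 / ε ^ 2) * (1 - ‖u x‖ ^ 2)) • u x) →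
        (∀ x ∈ ball (0 : E2) r, ‖u x‖ ≤ 1) →
        (∫ x in ball (0 : E2) r, eDens ε u x) < δ₀ →
        ∀ x ∈ ball (0 : E2) (r / 2),
          r ^ 2 * eDens ε u x ≤ A * (∫ y in ball (0 : E2) r, eDens ε u y) := by
  have hm := mphi_pos
  have hm' := mpsi_pos
  set a : ℝ := mphi / (1024 * mpsi) with ha
  have ha0 : 0 < a := by positivity
  have ham : 1024 * mpsi * a = mphi := by rw [ha]; field_simp
  clear_value a
  refine ⟨min (1 / 2) (a * mphi / 8), ⟨by positivity, (min_le_left _ _).trans_lt (by norm_num)⟩,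
    128 / mphi, by positivity, ?_⟩
  intro F _ _ ε hε r hr u hu heq hb hE x hx
  set E := ∫ y in ball (0 : E2) r, eDens ε u y with hEdef
  have hEa : E < a * mphi / 8 := hE.trans_le (min_le_right _ _)
  have hec := eDens_contDiff ε hu
  have hE0 : 0 ≤ E := setIntegral_nonneg measurableSet_ball fun y _ => eDens_nonneg ε u y
  clear_value E
  have hcw : Continuous fun y : E2 => (r - ‖y‖) ^ 2 * eDens ε u y :=
    (by fun_prop : Continuous fun y : E2 => (r - ‖y‖) ^ 2).mul hec.continuous
  obtain ⟨x₀, hx₀, hmax⟩ := (isCompact_closedBall (0 : E2) r).exists_isMaxOn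
    ⟨0, mem_closedBall_self hr.le⟩ hcw.continuousOn
  have hmax' : ∀ y : E2, ‖y‖ ≤ r →
      (r - ‖y‖) ^ 2 * eDens ε u y ≤ (r - ‖x₀‖) ^ 2 * eDens ε u x₀ := fun y hy =>
    hmax (by simpa using hy)
  have hx₀' : ‖x₀‖ ≤ r := by simpa using hx₀
  have hM : (r - ‖x₀‖) ^ 2 * eDens ε u x₀ ≤ 32 / mphi * E := by
    set e₀ := eDens ε u x₀ with he₀
    have he₀0 : 0 ≤ e₀ := eDens_nonneg ε u x₀
    clear_value e₀
    rcases he₀0.eq_or_lt with h0 | hpos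
    · rw [← h0, mul_zero]; positivity
    rcases hx₀'.eq_or_lt with h1 | hlt
    · rw [h1]; simp; positivity
    set ρ := (r - ‖x₀‖) / 2 with hρ
    have hρ0 : 0 < ρ := by rw [hρ]; linarith
    have hrx : r - ‖x₀‖ = 2 * ρ := by rw [hρ]; ring
    set s := min ρ (Real.sqrt (a / e₀)) with hs
    have hs0 : 0 < s := lt_min hρ0 (Real.sqrt_pos.2 (by positivity))
    have hsa : s ^ 2 * e₀ ≤ a := by
      have : s ^ 2 ≤ a / e₀ := by
        calc s ^ 2 ≤ (Real.sqrt (a / e₀)) ^ 2 := by gcongr; exact min_le_right _ _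
          _ = a / e₀ := Real.sq_sqrt (by positivity)
      rwa [le_div_iff₀ hpos] at this
    have hnorm : ∀ y ∈ ball x₀ s, ‖y‖ ≤ r - ρ := by
      intro y hy
      rw [mem_ball, dist_eq_norm] at hy
      have h1 : ‖y‖ ≤ ‖x₀‖ + ‖y - x₀‖ := by
        simpa using norm_add_le x₀ (y - x₀)
      have h2 : s ≤ ρ := min_le_left _ _
      linarith
    have hsub : ball x₀ s ⊆ ball (0 : E2) r := by
      intro y hy
      have := hnorm y hy
      rw [mem_ball_zero_iff]
      linarith
    have h4 : ∀ y ∈ ball x₀ s, eDens ε u y ≤ 4 * e₀ := by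
      intro y hy
      have h1 := hnorm y hy
      have h2 := hmax' y (by linarith)
      rw [hrx] at h2
      have h3 : ρ ^ 2 * eDens ε u y ≤ (r - ‖y‖) ^ 2 * eDens ε u y := by
        have := eDens_nonneg ε u y
        gcongr
        linarith
      have h5 : ρ ^ 2 * eDens ε u y ≤ ρ ^ 2 * (4 * e₀) := by nlinarith
      exact le_of_mul_le_mul_left h5 (by positivity)
    have hmv := mean_value_ball hec (eDens_nonneg ε u) x₀ hs0 hsub
      (fun y hy => lap_e_lower hε hu heq hb (hsub hy) (h4 y hy))
    rw [← hEdef, ← he₀] at hmv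
    have hk : 1024 * e₀ ^ 2 * mpsi * s ^ 2 / 2 ≤ mphi * e₀ / 2 := by
      have : (s ^ 2 * e₀) * (1024 * e₀ * mpsi) ≤ a * (1024 * e₀ * mpsi) := by gcongr
      nlinarith
    have hmain : s ^ 2 * e₀ ≤ 8 / mphi * E := by
      have h1 : mphi * e₀ / 2 ≤ 4 / s ^ 2 * E := by linarith
      have h2 : mphi * e₀ / 2 * s ^ 2 ≤ 4 * E := by
        calc mphi * e₀ / 2 * s ^ 2 ≤ 4 / s ^ 2 * E * s ^ 2 := by gcongr
          _ = 4 * E := by field_simp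
      rw [div_mul_eq_mul_div, le_div_iff₀ hm]
      linarith
    rcases min_choice ρ (Real.sqrt (a / e₀)) with h | h
    · rw [← hs] at h
      rw [h] at hmain
      rw [hrx]
      calc (2 * ρ) ^ 2 * e₀ = 4 * (ρ ^ 2 * e₀) := by ring
        _ ≤ 4 * (8 / mphi * E) := by gcongr
        _ = 32 / mphi * E := by ring
    · exfalso
      rw [← hs] at h
      rw [h, Real.sq_sqrt (by positivity), div_mul_cancel₀ _ hpos.ne', div_mul_eq_mul_div,
        le_div_iff₀ hm] at hmain
      linarith
  rw [mem_ball_zero_iff] at hx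
  have h1 := hmax' x (by linarith)
  have h2 : (r / 2) ^ 2 * eDens ε u x ≤ (r - ‖x‖) ^ 2 * eDens ε u x := by
    have := eDens_nonneg ε u x
    gcongr
    linarith
  calc r ^ 2 * eDens ε u x = 4 * ((r / 2) ^ 2 * eDens ε u x) := by ring
    _ ≤ 4 * (32 / mphi * E) := by linarith
    _ = 128 / mphi * E := by ring

lemma ff_decay {ε ρ S : ℝ} (hε : 0 < ε) (hρ : 0 < ρ) {u : E2 → F} (hu : ContDiff ℝ (⊤ : ℕ∞) u)
    (x₁ : E2)
    (heq : ∀ x ∈ closedBall x₁ ρ, -lap u x = ((1 / ε ^ 2) * (1 - ‖u x‖ ^ 2)) • u x)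
    (hb : ∀ x ∈ closedBall x₁ ρ, ‖u x‖ ≤ 1)
    (hf : ∀ x ∈ closedBall x₁ ρ, ff u x ≤ 1 / 2)
    (hS0 : 0 ≤ S)
    (hS : ∀ x ∈ closedBall x₁ ρ, eDens ε u x ≤ S) :
    ff u x₁ ≤ 4 * ε ^ 2 * S + 4 * Real.exp (-(ρ / (2 * ε))) := by
  set D := Real.cosh (ρ / (2 * ε)) with hD
  have hD0 : 0 < D := Real.cosh_pos _
  set b0 : E2 → ℝ := fun x => Real.cosh ((x 0 - x₁ 0) / ε) with hb0
  set b1 : E2 → ℝ := fun x => Real.cosh ((x 1 - x₁ 1) / ε) with hb1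
  have c0 : ContDiff ℝ (⊤ : ℕ∞) b0 := cosh_contDiff _ _ _
  have c1 : ContDiff ℝ (⊤ : ℕ∞) b1 := cosh_contDiff _ _ _
  have cf := ff_contDiff hu
  have cb : ContDiff ℝ (⊤ : ℕ∞) fun x => (1 / D) * (b0 x + b1 x) := contDiff_const.mul (c0.add c1)
  have cc : ContDiff ℝ (⊤ : ℕ∞) fun x => 4 * ε ^ 2 * S + (1 / D) * (b0 x + b1 x) :=
    contDiff_const.add cb
  set w : E2 → ℝ := fun x => ff u x - (4 * ε ^ 2 * S + (1 / D) * (b0 x + b1 x)) with hw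
  have hlw : ∀ x, lap w x = lap (ff u) x - (1 / D) * (b0 x + b1 x) / ε ^ 2 := by
    intro x
    rw [hw, lap_sub cf cc, lap_add contDiff_const cb, lap_const, lap_const_mul (c0.add c1),
      lap_add c0 c1, hb0, hb1, lap_cosh, lap_cosh]
    ring
  have hmp := max_principle (cf.sub cc) x₁ hρ (w := w) ?_ ?_
  · have h1 : b0 x₁ = 1 := by simp [hb0]
    have h2 : b1 x₁ = 1 := by simp [hb1]
    have h3 : (1 / D) * (1 + 1) ≤ 4 * Real.exp (-(ρ / (2 * ε))) := by
      have : Real.exp (ρ / (2 * ε)) / 2 ≤ D := by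
        rw [hD, Real.cosh_eq]
        have := Real.exp_pos (-(ρ / (2 * ε)))
        linarith
      rw [Real.exp_neg, ← div_eq_mul_inv, div_mul_eq_mul_div, div_le_div_iff₀ hD0 (Real.exp_pos _)]
      linarith
    simp only [hw, h1, h2] at hmp
    linarith
  · intro x hx hpos
    have hx' := ball_subset_closedBall hx
    rw [hlw, lap_ff hu]
    have hlapu : lap u x = (- (1 / ε ^ 2) * ff u x) • u x := by
      rw [← neg_neg (lap u x), heq x hx', ff_eq, ← neg_smul]
      congr 1
      ring
    have e1 : inner ℝ (u x) (u x) = 1 - ff u x := by simp [ff]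
    rw [hlapu, real_inner_smul_right, e1]
    have hg : gradSqNorm u x ≤ 2 * S := by
      have := hS x hx'
      rw [eDens_ff] at this
      have h0 : 0 ≤ ff u x ^ 2 / (4 * ε ^ 2) := by positivity
      linarith
    have hf0 := ff_nonneg (hb x hx')
    have hf1 := hf x hx'
    simp only [hw] at hpos
    generalize (1 / D) * (b0 x + b1 x) = B at *
    generalize ff u x = f at *
    have hp : 4 * S < (f - B) / ε ^ 2 := by
      rw [lt_div_iff₀ (by positivity)]
      linarith
    have h5 : f / ε ^ 2 ≤ 2 * (1 / ε ^ 2) * f * (1 - f) := by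
      have : 0 ≤ (1 / ε ^ 2) * (f * (1 / 2 - f)) := by
        have := mul_nonneg hf0 (sub_nonneg.2 hf1)
        positivity
      have h6 : f / ε ^ 2 = (1 / ε ^ 2) * f := by ring
      rw [h6]
      nlinarith
    rw [sub_div] at hp
    linarith
  · intro x hx
    have hx' : x ∈ closedBall x₁ ρ := sphere_subset_closedBall hx
    rw [mem_sphere, dist_eq_norm] at hx
    have hn : (x 0 - x₁ 0) ^ 2 + (x 1 - x₁ 1) ^ 2 = ρ ^ 2 := by
      rw [← hx, EuclideanSpace.norm_sq_eq]
      simp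
    have hcase : ρ / 2 ≤ |x 0 - x₁ 0| ∨ ρ / 2 ≤ |x 1 - x₁ 1| := by
      by_contra! h
      have a0 := sq_lt_sq' (by linarith [abs_nonneg (x 0 - x₁ 0)]) h.1
      have a1 := sq_lt_sq' (by linarith [abs_nonneg (x 1 - x₁ 1)]) h.2
      rw [sq_abs] at a0 a1
      nlinarith
    have hcosh : ∀ d : ℝ, ρ / 2 ≤ |d| → D ≤ Real.cosh (d / ε) := by
      intro d hd
      rw [hD, Real.cosh_le_cosh, abs_div d, abs_of_pos hε,
        abs_of_pos (by positivity : 0 < ρ / (2 * ε))]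
      rw [div_le_div_iff₀ (by positivity) hε]
      nlinarith
    have hsum : D ≤ b0 x + b1 x := by
      have p0 : 0 < b0 x := Real.cosh_pos _
      have p1 : 0 < b1 x := Real.cosh_pos _
      rcases hcase with h | h
      · have : D ≤ b0 x := hcosh _ h
        linarith
      · have : D ≤ b1 x := hcosh _ h
        linarith
    have h1 : 1 ≤ (1 / D) * (b0 x + b1 x) := by
      rw [div_mul_eq_mul_div, le_div_iff₀ hD0]
      linarith
    have := ff_le_one u x
    have h2 : 0 ≤ 4 * ε ^ 2 * S := by positivity
    simp only [hw]
    linarith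

end main

/-- second-order pointwise estimate under small energy
(Corollary 1.3 of the paper). -/
theorem ginzburg_landau_small_energy_laplacian_estimate
    (n : ℕ) (hn : 1 ≤ n) :
    ∃ δ₀ ∈ Set.Ioo (0 : ℝ) 1, ∃ C > (0 : ℝ), ∃ c > (0 : ℝ),
      ∀ (ε : ℝ), 0 < ε → ∀ (r : ℝ), 0 < r →
      ∀ (u : E2 → EuclideanSpace ℝ (Fin (n + 1))),
        ContDiff ℝ (⊤ : ℕ∞) u →
        (∀ x ∈ ball (0 : E2) r,
          -lap u x = ((1 / ε ^ 2) * (1 - ‖u x‖ ^ 2)) • u x) →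
        (∀ x ∈ ball (0 : E2) r, ‖u x‖ ≤ 1) →
        (∫ x in ball (0 : E2) r, eDens ε u x) < δ₀ →
        ∀ x ∈ ball (0 : E2) (r / 4),
          r ^ 2 * ‖lap u x‖
            ≤ C * (∫ y in ball (0 : E2) r, eDens ε u y)
              + C * (r ^ 2 / ε ^ 2) * Real.exp (-(c * r / ε)) := by
  obtain ⟨δ₀, hδ, A, hA, hreg⟩ := small_energy
  refine ⟨δ₀, hδ, 16 * A + 4 + Real.exp ((A + 1) / 2), by positivity, 1 / 8, by norm_num, ?_⟩
  intro ε hε r hr u hu heq hb hE x hx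
  have hreg' := hreg _ ε hε r hr u hu heq hb hE
  set E := ∫ y in ball (0 : E2) r, eDens ε u y with hEdef
  have hE0 : 0 ≤ E := setIntegral_nonneg measurableSet_ball fun y _ => eDens_nonneg ε u y
  clear_value E
  have hE1 : E < 1 := hE.trans hδ.2
  have hxr : x ∈ ball (0 : E2) r := ball_subset_ball (by linarith) hx
  have hf0 := ff_nonneg (hb x hxr)
  have hlap : ‖lap u x‖ ≤ ff u x / ε ^ 2 := by
    rw [← norm_neg, heq x hxr, norm_smul, ← ff_eq, Real.norm_of_nonneg (by positivity)]
    calc 1 / ε ^ 2 * ff u x * ‖u x‖ ≤ 1 / ε ^ 2 * ff u x * 1 := by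
          have := hb x hxr
          gcongr
      _ = ff u x / ε ^ 2 := by ring
  have hexp : -(1 / 8 * r / ε) = -(r / 4 / (2 * ε)) := by
    field_simp
    norm_num
  rw [hexp]
  have hX := Real.exp_pos (-(r / 4 / (2 * ε)))
  have hY := Real.exp_pos ((A + 1) / 2)
  have hR : 0 ≤ r ^ 2 / ε ^ 2 := by positivity
  by_cases hcase : 4 * (A + 1) * ε ≤ r
  · have hsub : ∀ y ∈ closedBall x (r / 4), y ∈ ball (0 : E2) (r / 2) := by
      intro y hy
      rw [mem_ball_zero_iff] at hx ⊢
      rw [mem_closedBall, dist_eq_norm] at hy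
      have h1 : ‖y‖ ≤ ‖x‖ + ‖y - x‖ := by simpa using norm_add_le x (y - x)
      linarith
    have hsub' : ∀ y ∈ closedBall x (r / 4), y ∈ ball (0 : E2) r := fun y hy =>
      ball_subset_ball (by linarith) (hsub y hy)
    have heS : ∀ y ∈ closedBall x (r / 4), eDens ε u y ≤ A * E / r ^ 2 := by
      intro y hy
      rw [le_div_iff₀ (by positivity)]
      linarith [hreg' y (hsub y hy)]
    have hd := ff_decay hε (by positivity : 0 < r / 4) hu x (fun y hy => heq y (hsub' y hy))
      (fun y hy => hb y (hsub' y hy)) ?_ (by positivity : 0 ≤ A * E / r ^ 2) heS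
    · have h1 : r ^ 2 * ‖lap u x‖ ≤ r ^ 2 / ε ^ 2 *
          (4 * ε ^ 2 * (A * E / r ^ 2) + 4 * Real.exp (-(r / 4 / (2 * ε)))) := by
        calc r ^ 2 * ‖lap u x‖ ≤ r ^ 2 * (ff u x / ε ^ 2) := by gcongr
          _ = r ^ 2 / ε ^ 2 * ff u x := by ring
          _ ≤ _ := by gcongr
      have h2 : r ^ 2 / ε ^ 2 * (4 * ε ^ 2 * (A * E / r ^ 2)) = 4 * A * E := by
        field_simp
      rw [mul_add, h2] at h1
      have h3 : 0 ≤ (12 * A + 4 + Real.exp ((A + 1) / 2)) * E := by positivity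
      have h4 : 0 ≤ (16 * A + Real.exp ((A + 1) / 2)) *
        (r ^ 2 / ε ^ 2 * Real.exp (-(r / 4 / (2 * ε)))) := by positivity
      nlinarith
    · intro y hy
      have h1 := heS y hy
      rw [eDens_ff] at h1
      have h2 := gradSq_nonneg u y
      have h3 : ff u y ^ 2 / (4 * ε ^ 2) ≤ A * E / r ^ 2 := by linarith
      rw [div_le_div_iff₀ (by positivity) (by positivity)] at h3
      have h4 : (4 * (A + 1) * ε) ^ 2 ≤ r ^ 2 := by gcongr
      have h5 : A * E * (4 * ε ^ 2) ≤ A * 1 * (4 * ε ^ 2) := by gcongr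
      by_contra! hlt
      have h6 : (1 / 2 : ℝ) ^ 2 < ff u y ^ 2 := by gcongr
      have h7 : (1 / 2 : ℝ) ^ 2 * r ^ 2 < ff u y ^ 2 * r ^ 2 := by gcongr
      have h8 : 0 < ε ^ 2 := by positivity
      nlinarith [mul_pos hA h8, mul_pos (mul_pos hA hA) h8]
  · push Not at hcase
    have h1 : 1 ≤ Real.exp ((A + 1) / 2) * Real.exp (-(r / 4 / (2 * ε))) := by
      rw [← Real.exp_add]
      apply Real.one_le_exp
      have : r / 4 / (2 * ε) ≤ (A + 1) / 2 := by
        rw [div_le_div_iff₀ (by positivity) (by norm_num)]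
        nlinarith
      linarith
    have h2 : r ^ 2 * ‖lap u x‖ ≤ r ^ 2 / ε ^ 2 * 1 := by
      calc r ^ 2 * ‖lap u x‖ ≤ r ^ 2 * (ff u x / ε ^ 2) := by gcongr
        _ = r ^ 2 / ε ^ 2 * ff u x := by ring
        _ ≤ _ := by gcongr; exact ff_le_one u x
    have h3 : r ^ 2 / ε ^ 2 * 1 ≤ r ^ 2 / ε ^ 2 *
        (Real.exp ((A + 1) / 2) * Real.exp (-(r / 4 / (2 * ε)))) := by gcongr
    have h4 : 0 ≤ (16 * A + 4 + Real.exp ((A + 1) / 2)) * E := by positivity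
    have h5 : 0 ≤ (16 * A + 4) *
        (r ^ 2 / ε ^ 2 * Real.exp (-(r / 4 / (2 * ε)))) := by positivity
    nlinarith
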